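/- Let n ≥ 1 and let z : ℝ → ℂ \ {0} be a smooth, 2π-periodic, regular closed curve that is austere (⟨ν,e_r⟩ > −1 everywhere) and tamed (f > 0 everywhere). Then z is starshaped (⟨ν,e_r⟩ > 0 everywhere), and the function δ := rⁿ·⟨ν,e_r⟩ satisfies δ(φ) ≥ ρⁿ for all φ, where ρ := min_{ψ ∈ [0,2π]} r(ψ). -/

import Mathlib

open Real Set

/-- Euclidean inner product on ℂ ≅ ℝ²: ⟨a,b⟩ = Re(conj a · b). -/
noncomputable def ip (a b : ℂ) : ℝ := a.re * b.re + a.im * b.im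

/-- Outward unit normal ν = (∂_φ v − i ∂_φ u)/√g of a regular curve z = u + iv. -/
noncomputable def nu (z : ℝ → ℂ) (φ : ℝ) : ℂ :=
  (‖deriv z φ‖)⁻¹ • (⟨(deriv z φ).im, -(deriv z φ).re⟩ : ℂ)

/-- Curvature k = (u'v'' − v'u'')/g^{3/2}. -/
noncomputable def curv (z : ℝ → ℂ) (φ : ℝ) : ℝ :=
  ((deriv z φ).re * (deriv (deriv z) φ).im -
    (deriv z φ).im * (deriv (deriv z) φ).re) / ‖deriv z φ‖ ^ 3

/-- f = k + (n−1)⟨z,ν⟩/|z|². -/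
noncomputable def fq (n : ℕ) (z : ℝ → ℂ) (φ : ℝ) : ℝ :=
  curv z φ + ((n : ℝ) - 1) * ip (z φ) (nu z φ) / ‖z φ‖ ^ 2

/-- Tangential Laplacian Δh = (1/√g)∂_φ(∂_φ h/√g) along the curve z. -/
noncomputable def lap (z : ℝ → ℂ) (h : ℝ → ℝ) (φ : ℝ) : ℝ :=
  (deriv (fun ψ => deriv h ψ / ‖deriv z ψ‖) φ) / ‖deriv z φ‖

/-- ⟨ν, e_r⟩ = ⟨z,ν⟩/|z|. -/
noncomputable def ner (z : ℝ → ℂ) (φ : ℝ) : ℝ := ip (z φ) (nu z φ) / ‖z φ‖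

lemma HasDerivAt.norm_complex {c : ℝ → ℂ} {c' : ℂ} {x : ℝ} (h : HasDerivAt c c' x)
    (h0 : c x ≠ 0) : HasDerivAt (fun t => ‖c t‖) (ip (c x) c' / ‖c x‖) x := by
  have key := h.norm_sq.sqrt (pow_ne_zero 2 (norm_ne_zero_iff.mpr h0))
  simp only [Real.sqrt_sq (norm_nonneg _)] at key
  have hpos : ‖c x‖ ≠ 0 := norm_ne_zero_iff.mpr h0
  convert key using 1
  simp only [ip, Complex.inner, Complex.mul_re, Complex.conj_re, Complex.conj_im]
  field_simp
  ring

lemma HasDerivAt.complex_re {c : ℝ → ℂ} {c' : ℂ} {x : ℝ} (h : HasDerivAt c c' x) :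
    HasDerivAt (fun t => (c t).re) c'.re x :=
  Complex.reCLM.hasFDerivAt.comp_hasDerivAt x h

lemma HasDerivAt.complex_im {c : ℝ → ℂ} {c' : ℂ} {x : ℝ} (h : HasDerivAt c c' x) :
    HasDerivAt (fun t => (c t).im) c'.im x :=
  Complex.imCLM.hasFDerivAt.comp_hasDerivAt x h

lemma norm_sq_eq_re_im (w : ℂ) : ‖w‖ ^ 2 = w.re ^ 2 + w.im ^ 2 := by
  rw [Complex.sq_norm, Complex.normSq_apply]; ring

lemma ip_nu (z : ℝ → ℂ) (φ : ℝ) :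
    ip (z φ) (nu z φ) =
      ((z φ).re * (deriv z φ).im - (z φ).im * (deriv z φ).re) / ‖deriv z φ‖ := by
  simp only [ip, nu, Complex.smul_re, Complex.smul_im, smul_eq_mul]
  ring

/-- The derivative of `δ = rⁿ⟨ν,e_r⟩` is `rⁿ⁻¹ f ⟨z, ∂_φ z⟩`. -/
lemma hasDerivAt_norm_pow_mul_ner {m : ℕ} {z : ℝ → ℂ} {φ : ℝ}
    (hz : ∀ φ, DifferentiableAt ℝ z φ) (hw : DifferentiableAt ℝ (deriv z) φ)
    (hreg : deriv z φ ≠ 0) (hnz : ∀ φ, z φ ≠ 0) :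
    HasDerivAt (fun t => ‖z t‖ ^ (m + 1) * ner z t)
      (‖z φ‖ ^ m * fq (m + 1) z φ * ip (z φ) (deriv z φ)) φ := by
  have h1 := (hz φ).hasDerivAt
  have h2 := hw.hasDerivAt
  have hR : ‖z φ‖ ≠ 0 := norm_ne_zero_iff.mpr (hnz φ)
  have hW : ‖deriv z φ‖ ≠ 0 := norm_ne_zero_iff.mpr hreg
  have hP := (h1.complex_re.mul h2.complex_im).sub (h1.complex_im.mul h2.complex_re)
  have key := ((h1.norm_complex (hnz φ)).pow m).mul (hP.div (h2.norm_complex hreg) hW)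
  have heq : (fun t => ‖z t‖ ^ (m + 1) * ner z t) = fun t => ‖z t‖ ^ m *
      (((z t).re * (deriv z t).im - (z t).im * (deriv z t).re) / ‖deriv z t‖) := by
    funext t
    have : ‖z t‖ ≠ 0 := norm_ne_zero_iff.mpr (hnz t)
    rw [ner, ip_nu]
    field_simp
    ring
  rw [heq]
  refine key.congr_deriv ?_
  have hW2 := norm_sq_eq_re_im (deriv z φ)
  rw [fq, ip_nu]
  simp only [Pi.mul_apply, Pi.sub_apply, Pi.div_apply, Pi.pow_apply, curv, ip, Nat.cast_add,
    Nat.cast_one, add_sub_cancel_right]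
  generalize ‖z φ‖ = R at *
  generalize ‖deriv z φ‖ = W at *
  generalize (deriv (deriv z) φ).re = p at *
  generalize (deriv (deriv z) φ).im = q at *
  generalize (deriv z φ).re = c at *
  generalize (deriv z φ).im = d at *
  generalize (z φ).re = a at *
  generalize (z φ).im = b at *
  have hpow : (m : ℝ) * R ^ (m - 1) = m * R ^ m / R := by
    rcases m with _ | m
    · simp
    · rw [Nat.add_sub_cancel, pow_succ]; field_simp
  rw [hpow]
  field_simp
  linear_combination (R ^ 2 * (a * q - b * p)) * hW2

/-- A closed austere and tamed curve is starshaped, and δ = rⁿ⟨ν,e_r⟩ satisfies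
δ ≥ ρⁿ where ρ = min r over a period. -/
theorem austere_tamed_starshaped (n : ℕ) (hn : 1 ≤ n) (z : ℝ → ℂ)
    (hsm : ContDiff ℝ (⊤ : ℕ∞) z) (hper : ∀ φ, z (φ + 2 * π) = z φ)
    (hreg : ∀ φ, deriv z φ ≠ 0) (hnz : ∀ φ, z φ ≠ 0)
    (haustere : ∀ φ : ℝ, -1 < ner z φ)
    (htamed : ∀ φ : ℝ, 0 < fq n z φ) :
    (∀ φ : ℝ, 0 < ner z φ) ∧
    (∀ φ : ℝ, (sInf ((fun ψ => ‖z ψ‖) '' Icc (0:ℝ) (2 * π))) ^ n ≤ ‖z φ‖ ^ n * ner z φ) := by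
  obtain ⟨m, rfl⟩ : ∃ m, n = m + 1 := ⟨n - 1, by omega⟩
  have hz : Differentiable ℝ z := hsm.differentiable (by simp)
  have hw : Differentiable ℝ (deriv z) :=
    (contDiff_infty_iff_deriv.mp hsm).2.differentiable (by simp)
  have hδ := fun φ => hasDerivAt_norm_pow_mul_ner (m := m) hz (hw φ) (hreg φ) hnz
  have hzper : Function.Periodic z (2 * π) := hper
  have hwper : ∀ φ, deriv z (φ + 2 * π) = deriv z φ := fun φ => by
    rw [← deriv_comp_add_const, funext hper]
  have hδper : Function.Periodic (fun t => ‖z t‖ ^ (m + 1) * ner z t) (2 * π) := fun φ => by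
    simp only [ner, nu, hper, hwper]
  have hne : (Icc (0 : ℝ) (2 * π)).Nonempty := nonempty_Icc.mpr two_pi_pos.le
  have hrc : ContinuousOn (fun ψ => ‖z ψ‖) (Icc (0 : ℝ) (2 * π)) :=
    hz.continuous.norm.continuousOn
  set ρ := sInf ((fun ψ => ‖z ψ‖) '' Icc (0 : ℝ) (2 * π)) with hρ
  have hρle : ∀ φ, ρ ≤ ‖z φ‖ := fun φ => by
    obtain ⟨y, hy, hyz⟩ := hzper.exists_mem_Ico₀ two_pi_pos φ
    rw [hyz]
    exact csInf_le (isCompact_Icc.image_of_continuousOn hrc).bddBelow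
      (mem_image_of_mem _ (Ico_subset_Icc_self hy))
  have hρpos : 0 < ρ := by
    obtain ⟨x, -, hx⟩ := isCompact_Icc.exists_sInf_image_eq hne hrc
    rw [hρ, hx]
    exact norm_pos_iff.mpr (hnz x)
  obtain ⟨x, -, hx⟩ := isCompact_Icc.exists_isMinOn hne
    (fun y _ => (hδ y).continuousAt.continuousWithinAt)
  have hmin : ∀ φ, ‖z x‖ ^ (m + 1) * ner z x ≤ ‖z φ‖ ^ (m + 1) * ner z φ := fun φ => by
    obtain ⟨y, hy, hyz⟩ := hδper.exists_mem_Ico₀ two_pi_pos φ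
    exact (hx (Ico_subset_Icc_self hy)).trans_eq hyz.symm
  have hT : ip (z x) (deriv z x) = 0 := by
    have h0 := IsLocalMin.hasDerivAt_eq_zero (Filter.Eventually.of_forall hmin) (hδ x)
    have hpos : 0 < ‖z x‖ ^ m * fq (m + 1) z x :=
      mul_pos (pow_pos (norm_pos_iff.mpr (hnz x)) m) (htamed x)
    exact (mul_eq_zero.mp h0).resolve_left hpos.ne'
  have hner : ner z x = 1 := by
    have hsq : ner z x ^ 2 = 1 := by
      have hR : ‖z x‖ ≠ 0 := norm_ne_zero_iff.mpr (hnz x)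
      have hW : ‖deriv z x‖ ≠ 0 := norm_ne_zero_iff.mpr (hreg x)
      rw [ner, ip_nu, div_pow, div_pow, norm_sq_eq_re_im (z x), norm_sq_eq_re_im (deriv z x),
        div_div, div_eq_one_iff_eq]
      · rw [ip] at hT
        linear_combination (-((z x).re * (deriv z x).re + (z x).im * (deriv z x).im)) * hT
      · rw [← norm_sq_eq_re_im, ← norm_sq_eq_re_im]
        positivity
    rcases eq_or_eq_neg_of_sq_eq_sq (ner z x) 1 (by rw [hsq, one_pow]) with h | h
    · exact h
    · linarith [haustere x]
  have hbound : ∀ φ, ρ ^ (m + 1) ≤ ‖z φ‖ ^ (m + 1) * ner z φ := fun φ => by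
    refine le_trans ?_ (hmin φ)
    rw [hner, mul_one]
    exact pow_le_pow_left₀ hρpos.le (hρle x) _
  exact ⟨fun φ => pos_of_mul_pos_right ((pow_pos hρpos _).trans_le (hbound φ)) (by positivity),
    hbound⟩
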